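/- Let a, b, c be real constants with c > 0, b > 0 and b² + 24ac ≥ 0, and set s₊ = (b + √(b² + 24ac))/(4c) (so s₊ > 0). Let Q ∈ Q₀, and suppose λ₁ ≤ λ₂ ≤ λ₃ are real numbers and u₁, u₂, u₃ is an orthonormal basis of ℝ³ with Q·uᵢ = λᵢuᵢ for i = 1,2,3 (so λ₁ + λ₂ + λ₃ = 0). Then dist(Q, N)² = (λ₁ + s₊/3)² + (λ₂ + s₊/3)² + (λ₃ - 2s₊/3)². -/

import Mathlib

noncomputable section

open Matrix

/-- The space of 3×3 real matrices. -/
abbrev Mat3 := Matrix (Fin 3) (Fin 3) ℝ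

/-- Frobenius inner product `A : B = ∑ᵢⱼ Aᵢⱼ Bᵢⱼ`. -/
def frob (A B : Mat3) : ℝ := ∑ i, ∑ j, A i j * B i j

/-- Frobenius norm. -/
def fnorm (A : Mat3) : ℝ := Real.sqrt (frob A A)

/-- The uniaxial matrix `s (d ⊗ d - (1/3) I)`. -/
def uniax (s : ℝ) (d : Fin 3 → ℝ) : Mat3 :=
  s • (vecMulVec d d - (1 / 3 : ℝ) • (1 : Mat3))

/-- The distance (in Frobenius norm) from `Q` to the limit manifold
`N = { s(d⊗d - (1/3)I) : |d| = 1 }`. -/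
def distN (s : ℝ) (Q : Mat3) : ℝ :=
  sInf ((fun d : Fin 3 → ℝ => fnorm (Q - uniax s d)) '' {d | ∑ i, d i ^ 2 = 1})

/-- A matrix with orthonormal eigenvectors is orthogonally diagonalized by them. -/
lemma eq_transpose_mul_diagonal_mul {Q : Mat3} {l : Fin 3 → ℝ} {U : Mat3}
    (hU : U * Uᵀ = 1) (heig : ∀ i, Q *ᵥ U i = l i • U i) :
    Q = Uᵀ * diagonal l * U := by
  have hQ : Q * Uᵀ = Uᵀ * diagonal l := by
    ext i j
    have hij := congrFun (heig j) i
    simp only [mulVec, dotProduct, Pi.smul_apply, smul_eq_mul] at hij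
    rw [mul_diagonal, transpose_apply, mul_comm, ← hij]
    rfl
  rw [← hQ, Matrix.mul_assoc, mul_eq_one_comm.mp hU, Matrix.mul_one]

lemma trace_transpose_mul_mul {U : Mat3} (hU : U * Uᵀ = 1) (A : Mat3) :
    (Uᵀ * A * U).trace = A.trace := by
  rw [Matrix.mul_assoc, trace_mul_comm, Matrix.mul_assoc, hU, Matrix.mul_one]

lemma frob_self_eq_sum_sq {Q : Mat3} (hsym : Q.IsSymm) {l : Fin 3 → ℝ} {U : Mat3}
    (hU : U * Uᵀ = 1) (hQ : Q = Uᵀ * diagonal l * U) :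
    frob Q Q = ∑ i, l i ^ 2 := by
  have hQQ : frob Q Q = (Q * Q).trace := by
    simp only [frob, trace, diag_apply, mul_apply]
    exact Finset.sum_congr rfl fun i _ => Finset.sum_congr rfl fun j _ => by
      rw [hsym.apply i j]
  have hmul : Q * Q = Uᵀ * (diagonal l * diagonal l) * U := by
    calc Q * Q = Uᵀ * diagonal l * (U * Uᵀ) * diagonal l * U := by
          rw [hQ]; simp only [Matrix.mul_assoc]
      _ = _ := by rw [hU]; simp only [Matrix.mul_assoc, Matrix.mul_one]
  rw [hQQ, hmul, trace_transpose_mul_mul hU, diagonal_mul_diagonal, trace_diagonal]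
  simp only [sq]

lemma dotProduct_mulVec_eq_sum {Q U : Mat3} {l : Fin 3 → ℝ}
    (hQ : Q = Uᵀ * diagonal l * U) (d : Fin 3 → ℝ) :
    d ⬝ᵥ Q *ᵥ d = ∑ i, l i * (U *ᵥ d) i ^ 2 := by
  rw [hQ, ← mulVec_mulVec, ← mulVec_mulVec, dotProduct_mulVec, vecMul_transpose]
  simp only [dotProduct, mulVec_diagonal]
  exact Finset.sum_congr rfl fun i _ => by ring

lemma sum_sq_mulVec {U : Mat3} (hU : U * Uᵀ = 1) (d : Fin 3 → ℝ) :
    ∑ i, (U *ᵥ d) i ^ 2 = ∑ i, d i ^ 2 := by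
  have hd : U *ᵥ d ⬝ᵥ U *ᵥ d = d ⬝ᵥ d := by
    rw [dotProduct_mulVec, ← mulVec_transpose, mulVec_mulVec, mul_eq_one_comm.mp hU, one_mulVec]
  simpa only [dotProduct, sq] using hd

/-- The squared Frobenius distance from a traceless matrix to a uniaxial one. -/
lemma frob_sub_uniax {Q : Mat3} (htr : Q.trace = 0) (s : ℝ) {d : Fin 3 → ℝ}
    (hd : ∑ i, d i ^ 2 = 1) :
    frob (Q - uniax s d) (Q - uniax s d) =
      frob Q Q - 2 * s * (d ⬝ᵥ Q *ᵥ d) + 2 / 3 * s ^ 2 := by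
  simp only [trace, diag_apply, Fin.sum_univ_three] at htr hd
  simp [frob, uniax, dotProduct, mulVec, vecMulVec_apply, Fin.sum_univ_three]
  linear_combination (2 / 3 * s) * htr +
    s ^ 2 * (d 0 ^ 2 + d 1 ^ 2 + d 2 ^ 2 + 1 / 3) * hd

lemma frob_self_nonneg (A : Mat3) : 0 ≤ frob A A :=
  Finset.sum_nonneg fun _ _ => Finset.sum_nonneg fun _ _ => mul_self_nonneg _

/-- for `c > 0`, `b > 0`, `b² + 24ac ≥ 0` and
`s₊ = (b + √(b²+24ac))/(4c)`, if `Q ∈ Q₀` has eigenvalues `λ₁ ≤ λ₂ ≤ λ₃`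
with an orthonormal eigenbasis `u₁, u₂, u₃`, then
`dist(Q,N)² = (λ₁ + s₊/3)² + (λ₂ + s₊/3)² + (λ₃ - 2s₊/3)²`. -/
theorem stmt11 (a b c : ℝ) (hc : 0 < c) (hb : 0 < b)
    (h : 0 ≤ b ^ 2 + 24 * a * c)
    (s : ℝ) (hs : s = (b + Real.sqrt (b ^ 2 + 24 * a * c)) / (4 * c))
    (Q : Mat3) (hsym : Q.IsSymm) (htr : Q.trace = 0)
    (l : Fin 3 → ℝ) (h12 : l 0 ≤ l 1) (h23 : l 1 ≤ l 2)
    (u : Fin 3 → Fin 3 → ℝ)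
    (huorth : ∀ i j : Fin 3, ∑ k, u i k * u j k = if i = j then 1 else 0)
    (heig : ∀ i : Fin 3, Q.mulVec (u i) = l i • u i) :
    (distN s Q) ^ 2 =
      (l 0 + s / 3) ^ 2 + (l 1 + s / 3) ^ 2 + (l 2 - 2 * s / 3) ^ 2 := by
  have hU : Matrix.of u * (Matrix.of u)ᵀ = 1 := by
    ext i j
    simpa [mul_apply, one_apply] using huorth i j
  have hQ := eq_transpose_mul_diagonal_mul hU heig
  have hl : l 0 + l 1 + l 2 = 0 := by
    rw [hQ, trace_transpose_mul_mul hU, trace_diagonal, Fin.sum_univ_three] at htr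
    exact htr
  have hfrob := frob_self_eq_sum_sq hsym hU hQ
  have hs0 : 0 ≤ s := by rw [hs]; positivity
  have hu : ∑ i, u 2 i ^ 2 = 1 := by simpa [sq] using huorth 2 2
  have hleast : IsLeast ((fun d : Fin 3 → ℝ => fnorm (Q - uniax s d)) ''
      {d | ∑ i, d i ^ 2 = 1}) (fnorm (Q - uniax s (u 2))) := by
    refine ⟨⟨u 2, hu, rfl⟩, ?_⟩
    rintro _ ⟨d, hd, rfl⟩
    have hmax : d ⬝ᵥ Q *ᵥ d ≤ l 2 := by
      have hsq := sum_sq_mulVec hU d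
      rw [show ∑ i, d i ^ 2 = 1 from hd] at hsq
      calc d ⬝ᵥ Q *ᵥ d = ∑ i, l i * (Matrix.of u *ᵥ d) i ^ 2 := dotProduct_mulVec_eq_sum hQ d
        _ ≤ ∑ i, l 2 * (Matrix.of u *ᵥ d) i ^ 2 := by
          refine Finset.sum_le_sum fun i _ => mul_le_mul_of_nonneg_right ?_ (sq_nonneg _)
          fin_cases i
          exacts [h12.trans h23, h23, le_rfl]
        _ = l 2 := by rw [← Finset.mul_sum, hsq, mul_one]
    refine Real.sqrt_le_sqrt ?_
    rw [frob_sub_uniax htr s hu, frob_sub_uniax htr s hd, heig 2, dotProduct_smul,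
      show u 2 ⬝ᵥ u 2 = 1 by simpa [dotProduct] using huorth 2 2, smul_eq_mul, mul_one]
    linarith [mul_le_mul_of_nonneg_left hmax hs0]
  rw [distN, hleast.csInf_eq, fnorm, Real.sq_sqrt (frob_self_nonneg _), frob_sub_uniax htr s hu,
    heig 2, dotProduct_smul, show u 2 ⬝ᵥ u 2 = 1 by simpa [dotProduct] using huorth 2 2,
    hfrob, Fin.sum_univ_three, smul_eq_mul, mul_one]
  linear_combination (-2 / 3 * s) * hl
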